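/- Let F be a field, let k ≤ n be natural numbers with k ≥ 1, and let α_1, ..., α_n be n pairwise distinct elements of F. If P and Q are two distinct polynomials over F each of degree strictly less than k, then the evaluation vectors (P(α_1), ..., P(α_n)) and (Q(α_1), ..., Q(α_n)) differ in at least n − k + 1 coordinates; equivalently, their Hamming distance is at least n − k + 1. -/

import Mathlib

/-- **Reed–Solomon minimum distance.** For `1 ≤ k ≤ n` and pairwise distinct
evaluation points `α 1, …, α n` in a field `F`, two distinct polynomials of
degree `< k` have evaluation vectors at Hamming distance at least `n - k + 1`. -/
theorem reedSolomon_min_distance {F : Type*} [Field F] [DecidableEq F] (n k : ℕ)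
    (hk : 1 ≤ k) (hkn : k ≤ n) (α : Fin n → F) (hα : Function.Injective α)
    (P Q : Polynomial F) (hP : P.degree < (k : ℕ)) (hQ : Q.degree < (k : ℕ))
    (hPQ : P ≠ Q) :
    n - k + 1 ≤ hammingDist (fun i => P.eval (α i)) (fun i => Q.eval (α i)) := by
  by_contra hlt
  apply hPQ
  have hsum := Finset.card_filter_add_card_filter_not (s := (Finset.univ : Finset (Fin n)))
    (fun i => P.eval (α i) ≠ Q.eval (α i))
  rw [Finset.card_univ, Fintype.card_fin] at hsum
  have hd : hammingDist (fun i => P.eval (α i)) (fun i => Q.eval (α i))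
      = (Finset.univ.filter (fun i => P.eval (α i) ≠ Q.eval (α i))).card := rfl
  have hcard : k ≤ (Finset.univ.filter (fun i => ¬ P.eval (α i) ≠ Q.eval (α i))).card := by
    omega
  have hc : ((k : ℕ) : WithBot ℕ) ≤
      ((Finset.univ.filter (fun i => ¬ P.eval (α i) ≠ Q.eval (α i))).card : WithBot ℕ) := by
    exact_mod_cast hcard
  refine Polynomial.eq_of_degrees_lt_of_eval_index_eq _ (hα.injOn)
    (lt_of_lt_of_le hP hc) (lt_of_lt_of_le hQ hc) ?_
  intro i hi
  simpa using hi
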